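/- arXiv:2403.08394 — 2 statements merged into one kernel-verified Lean document; each statement's English description precedes it below -/
import Mathlib

section
/- Let H be a core-gadget graph on V ⊔ L ⊔ R with parameters N, d ≥ 3 and 0 < φ ≤ 1. Then H is a (φ/10)-expander: for every cut ∅ ≠ S ⊊ V ⊔ L ⊔ R, min(vol_H(S), vol_H(complement)) > 0 and e_H(S, complement) ≥ (φ/10) · min(vol_H(S), vol_H(complement)). -/
open Finset

variable {W : Type*}

/-- The volume of a set of vertices: the sum of their degrees. -/
def vol (H : SimpleGraph W) [Fintype W] [DecidableRel H.Adj] (S : Finset W) : ℕ :=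
  ∑ v ∈ S, H.degree v

/-- The number of edges of `H` with one endpoint in `S` and the other in `T`
(for disjoint `S` and `T`), counted as ordered pairs in `S × T`. -/
def ecount (H : SimpleGraph W) [DecidableRel H.Adj] (S T : Finset W) : ℕ :=
  ((S ×ˢ T).filter fun p => H.Adj p.1 p.2).card

/-- `H` is a `φ`-expander: for every cut `∅ ≠ S ⊊ W`,
`min(vol(S), vol(Sᶜ)) > 0` and `e(S, Sᶜ) ≥ φ · min(vol(S), vol(Sᶜ))`. -/
def IsExpander [Fintype W] [DecidableEq W] (H : SimpleGraph W) [DecidableRel H.Adj]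
    (φ : ℝ) : Prop :=
  ∀ S : Finset W, S.Nonempty → S ≠ Finset.univ →
    0 < min (vol H S) (vol H Sᶜ) ∧
    φ * (min (vol H S) (vol H Sᶜ) : ℝ) ≤ (ecount H S Sᶜ : ℝ)

/-- A core-gadget graph on `V ⊔ L ⊔ R` with parameters `N`, `d ≥ 3` and `0 < φ ≤ 1`. -/
structure IsCoreGadget [Fintype W] [DecidableEq W] (H : SimpleGraph W) [DecidableRel H.Adj]
    (V L R : Finset W) (N d : ℕ) (φ : ℝ) : Prop where
  hLcard : L.card = N
  hRcard : R.card = N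
  hN : 1 ≤ N
  hd : 3 ≤ d
  hφ0 : 0 < φ
  hφ1 : φ ≤ 1
  hVL : Disjoint V L
  hVR : Disjoint V R
  hLR : Disjoint L R
  hcover : V ∪ L ∪ R = Finset.univ
  /-- (i) every edge lies inside `V`, between `V` and `L`, or between `L` and `R`. -/
  hedge : ∀ u v : W, H.Adj u v →
    (u ∈ V ∧ v ∈ V) ∨ (u ∈ V ∧ v ∈ L) ∨ (u ∈ L ∧ v ∈ V) ∨
    (u ∈ L ∧ v ∈ R) ∨ (u ∈ R ∧ v ∈ L)
  /-- (ii) every `v ∈ V` has exactly `deg_G(v) + 3` neighbors in `L`,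
  where `G` is the subgraph induced on `V`. -/
  hVtoL : ∀ v ∈ V, (H.neighborFinset v ∩ L).card = (H.neighborFinset v ∩ V).card + 3
  /-- (iii) every `x ∈ L` has at most `d` neighbors in `V`. -/
  hLtoV : ∀ x ∈ L, (H.neighborFinset x ∩ V).card ≤ d
  /-- (iv) the bipartite graph `X` of `L–R` edges is `d`-regular ... -/
  hXregL : ∀ x ∈ L, (H.neighborFinset x ∩ R).card = d
  hXregR : ∀ y ∈ R, (H.neighborFinset y ∩ L).card = d
  /-- ... and satisfies `e_X(T, (L∪R)\T) ≥ φ·d·|T|` for all `T ⊆ L ∪ R` with `|T| ≤ N`. -/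
  hXexp : ∀ T ⊆ L ∪ R, T.card ≤ N →
    φ * (d : ℝ) * (T.card : ℝ) ≤
      ((ecount H (T ∩ L) (R \ T) + ecount H (T ∩ R) (L \ T) : ℕ) : ℝ)

theorem ecount_eq_sum [Fintype W] [DecidableEq W] (H : SimpleGraph W) [DecidableRel H.Adj]
    (S T : Finset W) : ecount H S T = ∑ v ∈ S, (H.neighborFinset v ∩ T).card := by
  rw [ecount, card_filter, sum_product]
  refine sum_congr rfl fun v _ => ?_
  rw [← card_filter]
  congr 1
  ext w
  simp [and_comm]

theorem ecount_comm (H : SimpleGraph W) [DecidableRel H.Adj] (S T : Finset W) :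
    ecount H S T = ecount H T S := by
  rw [ecount, ecount, card_filter, card_filter, sum_product_right, sum_product]
  simp only [H.adj_comm]

theorem ecount_mono_right (H : SimpleGraph W) [DecidableRel H.Adj] (S : Finset W)
    {T T' : Finset W} (h : T ⊆ T') : ecount H S T ≤ ecount H S T' :=
  card_le_card (filter_subset_filter _ (product_subset_product_right h))

theorem ecount_union_right [DecidableEq W] (H : SimpleGraph W) [DecidableRel H.Adj]
    (S : Finset W) {T T' : Finset W} (h : Disjoint T T') :
    ecount H S (T ∪ T') = ecount H S T + ecount H S T' := by
  simp only [ecount, card_filter, sum_product, sum_union h, sum_add_distrib]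

namespace IsCoreGadget

variable [Fintype W] [DecidableEq W] {H : SimpleGraph W} [DecidableRel H.Adj]
  {V L R : Finset W} {N d : ℕ} {φ : ℝ}

theorem degree_le_of_mem_V (h : IsCoreGadget H V L R N d φ) {v : W} (hv : v ∈ V) :
    H.degree v ≤ 2 * (H.neighborFinset v ∩ L).card := by
  have hsub : H.neighborFinset v ⊆ (H.neighborFinset v ∩ V) ∪ (H.neighborFinset v ∩ L) := by
    intro w hw
    have := h.hedge v w (by simpa using hw)
    have := disjoint_left.1 h.hVL hv
    have := disjoint_left.1 h.hVR hv
    simp only [mem_union, mem_inter]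
    tauto
  have := (card_le_card hsub).trans (card_union_le _ _)
  have := h.hVtoL v hv
  rw [← H.card_neighborFinset_eq_degree]
  omega

theorem degree_le_of_mem_L (h : IsCoreGadget H V L R N d φ) {x : W} (hx : x ∈ L) :
    H.degree x ≤ 2 * d := by
  have hsub : H.neighborFinset x ⊆ (H.neighborFinset x ∩ V) ∪ (H.neighborFinset x ∩ R) := by
    intro w hw
    have := h.hedge x w (by simpa using hw)
    have := disjoint_right.1 h.hVL hx
    have := disjoint_left.1 h.hLR hx
    simp only [mem_union, mem_inter]
    tauto
  have := (card_le_card hsub).trans (card_union_le _ _)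
  have := h.hLtoV x hx
  have := h.hXregL x hx
  rw [← H.card_neighborFinset_eq_degree]
  omega

theorem degree_le_of_mem_R (h : IsCoreGadget H V L R N d φ) {y : W} (hy : y ∈ R) :
    H.degree y ≤ d := by
  have hsub : H.neighborFinset y ⊆ H.neighborFinset y ∩ L := by
    intro w hw
    have := h.hedge y w (by simpa using hw)
    have := disjoint_right.1 h.hVR hy
    have := disjoint_right.1 h.hLR hy
    simp only [mem_inter]
    tauto
  rw [← H.card_neighborFinset_eq_degree, ← h.hXregR y hy]
  exact card_le_card hsub

theorem degree_pos (h : IsCoreGadget H V L R N d φ) (v : W) : 0 < H.degree v := by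
  have hle : ∀ T, (H.neighborFinset v ∩ T).card ≤ H.degree v := fun T =>
    (card_le_card inter_subset_left).trans_eq (H.card_neighborFinset_eq_degree v)
  have hd := h.hd
  have hv : v ∈ V ∪ L ∪ R := h.hcover ▸ mem_univ v
  rcases mem_union.1 hv with hv | hv
  · rcases mem_union.1 hv with hv | hv
    · have := h.hVtoL v hv
      have := hle L
      omega
    · have := h.hXregL v hv
      have := hle R
      omega
  · have := h.hXregR v hv
    have := hle L
    omega

theorem vol_pos (h : IsCoreGadget H V L R N d φ) {S : Finset W} (hS : S.Nonempty) :
    0 < vol H S :=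
  sum_pos (fun v _ => h.degree_pos v) hS

theorem sum_eq_add_add {M : Type*} [AddCommMonoid M] (h : IsCoreGadget H V L R N d φ)
    (S : Finset W) (f : W → M) :
    ∑ v ∈ S, f v = ∑ v ∈ S ∩ V, f v + ∑ v ∈ S ∩ L, f v + ∑ v ∈ S ∩ R, f v := by
  have hVL : Disjoint (S ∩ V) (S ∩ L) := h.hVL.mono inter_subset_right inter_subset_right
  have hVLR : Disjoint (S ∩ V ∪ S ∩ L) (S ∩ R) := by
    rw [← inter_union_distrib_left]
    exact (disjoint_union_left.2 ⟨h.hVR, h.hLR⟩).mono inter_subset_right inter_subset_right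
  rw [← sum_union hVL, ← sum_union hVLR, ← inter_union_distrib_left, ← inter_union_distrib_left,
    h.hcover, inter_univ]

theorem card_inter_union (h : IsCoreGadget H V L R N d φ) (S : Finset W) :
    (S ∩ (L ∪ R)).card = (S ∩ L).card + (S ∩ R).card := by
  rw [inter_union_distrib_left,
    card_union_of_disjoint (h.hLR.mono inter_subset_right inter_subset_right)]

theorem vol_le (h : IsCoreGadget H V L R N d φ) (S : Finset W) :
    vol H S ≤ 2 * ecount H (S ∩ V) L + 2 * (d * (S ∩ (L ∪ R)).card) := by
  have hV : ∑ v ∈ S ∩ V, H.degree v ≤ 2 * ecount H (S ∩ V) L := by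
    rw [ecount_eq_sum, mul_sum]
    exact sum_le_sum fun v hv => h.degree_le_of_mem_V (mem_inter.1 hv).2
  have hL : ∑ v ∈ S ∩ L, H.degree v ≤ (S ∩ L).card * (2 * d) :=
    sum_le_card_nsmul _ _ _ fun v hv => h.degree_le_of_mem_L (mem_inter.1 hv).2
  have hR : ∑ v ∈ S ∩ R, H.degree v ≤ (S ∩ R).card * d :=
    sum_le_card_nsmul _ _ _ fun v hv => h.degree_le_of_mem_R (mem_inter.1 hv).2
  rw [vol, h.sum_eq_add_add S, h.card_inter_union S]
  nlinarith

theorem ecount_V_L_le (h : IsCoreGadget H V L R N d φ) (S : Finset W) :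
    ecount H (S ∩ V) L ≤ ecount H (S ∩ V) (L \ S) + d * (S ∩ (L ∪ R)).card := by
  have hin : ecount H (S ∩ V) (L ∩ S) ≤ (L ∩ S).card * d := by
    rw [ecount_comm, ecount_eq_sum]
    refine sum_le_card_nsmul _ _ _ fun x hx => ?_
    exact (card_le_card (inter_subset_inter_left inter_subset_right)).trans
      (h.hLtoV x (mem_inter.1 hx).1)
  have hsplit : ecount H (S ∩ V) L = ecount H (S ∩ V) (L \ S) + ecount H (S ∩ V) (L ∩ S) := by
    rw [← ecount_union_right H _ (disjoint_sdiff_inter L S), sdiff_union_inter]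
  rw [h.card_inter_union S, hsplit, inter_comm S L]
  nlinarith

theorem le_ecount_compl (h : IsCoreGadget H V L R N d φ) (S : Finset W) :
    ecount H (S ∩ V) (L \ S) + ecount H (S ∩ L) (R \ S) + ecount H (S ∩ R) (L \ S) ≤
      ecount H S Sᶜ := by
  have hsub : ∀ T : Finset W, T \ S ⊆ Sᶜ := fun T x hx => mem_compl.2 (mem_sdiff.1 hx).2
  have hsplit : ecount H S Sᶜ =
      ecount H (S ∩ V) Sᶜ + ecount H (S ∩ L) Sᶜ + ecount H (S ∩ R) Sᶜ := by
    simp only [ecount_eq_sum]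
    exact h.sum_eq_add_add S _
  rw [hsplit]
  gcongr <;> exact ecount_mono_right H _ (hsub _)

theorem mul_vol_le_ecount_compl (h : IsCoreGadget H V L R N d φ) {S : Finset W}
    (hS : (S ∩ (L ∪ R)).card ≤ N) :
    φ / 10 * (vol H S : ℝ) ≤ (ecount H S Sᶜ : ℝ) := by
  have hexp := h.hXexp (S ∩ (L ∪ R)) inter_subset_right hS
  have hTL : S ∩ (L ∪ R) ∩ L = S ∩ L := by grind
  have hTR : S ∩ (L ∪ R) ∩ R = S ∩ R := by grind
  have hRT : R \ (S ∩ (L ∪ R)) = R \ S := by grind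
  have hLT : L \ (S ∩ (L ∪ R)) = L \ S := by grind
  rw [hTL, hTR, hRT, hLT, Nat.cast_add] at hexp
  have hvol : (vol H S : ℝ) ≤ 2 * ecount H (S ∩ V) L + 2 * (d * (S ∩ (L ∪ R)).card) := by
    exact_mod_cast h.vol_le S
  have hVL : (ecount H (S ∩ V) L : ℝ) ≤
      ecount H (S ∩ V) (L \ S) + d * (S ∩ (L ∪ R)).card := by
    exact_mod_cast h.ecount_V_L_le S
  have hcut : (ecount H (S ∩ V) (L \ S) : ℝ) + ecount H (S ∩ L) (R \ S) +
      ecount H (S ∩ R) (L \ S) ≤ ecount H S Sᶜ := by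
    exact_mod_cast h.le_ecount_compl S
  have hφ0 := h.hφ0
  have hdt : 0 ≤ φ * (d * ((S ∩ (L ∪ R)).card : ℝ)) := by positivity
  have hvol' := mul_le_mul_of_nonneg_left hvol hφ0.le
  have hVL' := mul_le_mul_of_nonneg_left hVL hφ0.le
  have hout : φ * (ecount H (S ∩ V) (L \ S) : ℝ) ≤ ecount H (S ∩ V) (L \ S) :=
    mul_le_of_le_one_left (Nat.cast_nonneg _) h.hφ1
  have hpos : (0 : ℝ) ≤ ecount H (S ∩ V) (L \ S) := Nat.cast_nonneg _
  nlinarith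

theorem card_inter_add_card_compl_inter (h : IsCoreGadget H V L R N d φ) (S : Finset W) :
    (S ∩ (L ∪ R)).card + (Sᶜ ∩ (L ∪ R)).card = 2 * N := by
  have hcompl : Sᶜ ∩ (L ∪ R) = (L ∪ R) \ S := by rw [sdiff_eq_inter_compl, inter_comm]
  rw [hcompl, inter_comm, card_inter_add_card_sdiff, card_union_of_disjoint h.hLR, h.hLcard,
    h.hRcard, two_mul]

end IsCoreGadget

/-- A core-gadget graph is a `(φ/10)`-expander. -/
theorem coreGadget_isExpander [Fintype W] [DecidableEq W]
    (H : SimpleGraph W) [DecidableRel H.Adj]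
    (V L R : Finset W) (N d : ℕ) (φ : ℝ)
    (hcg : IsCoreGadget H V L R N d φ) :
    IsExpander H (φ / 10) := by
  intro S hne huniv
  have hne' : Sᶜ.Nonempty := by simpa [nonempty_iff_ne_empty] using huniv
  refine ⟨lt_min (hcg.vol_pos hne) (hcg.vol_pos hne'), ?_⟩
  have hφ : 0 ≤ φ / 10 := by linarith [hcg.hφ0]
  have hsum := hcg.card_inter_add_card_compl_inter S
  rcases le_total (S ∩ (L ∪ R)).card N with hS | hS
  · exact (mul_le_mul_of_nonneg_left (min_le_left _ _) hφ).trans (hcg.mul_vol_le_ecount_compl hS)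
  · have hcut := hcg.mul_vol_le_ecount_compl (S := Sᶜ) (by omega)
    rw [compl_compl, ecount_comm] at hcut
    exact (mul_le_mul_of_nonneg_left (min_le_right _ _) hφ).trans hcut
end

section
/- Let H be a finite simple graph on vertex set V ⊔ L ⊔ R with |L| = |R| = N ≥ 1, and let 0 < ε ≤ 1, α ≥ 1, an integer d_X ≥ 3 and a real 0 < φ ≤ 1 be such that: (i) every edge of H lies inside V, between V and L, or between L and R; (ii) letting G denote the subgraph of H induced on V, every v ∈ V has at least ε·deg_G(v) + 1 neighbors in L; (iii) the bipartite graph X of L–R edges is d_X-regular and satisfies e_X(T, (L∪R)\T) ≥ φ·d_X·|T| for every T ⊆ L ∪ R with |T| ≤ N; (iv) every x ∈ L has degree in H in the interval [d_X, α·d_X]. Then H is a (φε/(5α))-expander. -/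
open Finset

variable {W : Type*}

theorem ecount_mono (H : SimpleGraph W) [DecidableRel H.Adj] {S S' T T' : Finset W}
    (hS : S ⊆ S') (hT : T ⊆ T') : ecount H S T ≤ ecount H S' T' :=
  Finset.card_le_card (Finset.filter_subset_filter _ (Finset.product_subset_product hS hT))

theorem ecount_le_vol [Fintype W] [DecidableEq W] (H : SimpleGraph W) [DecidableRel H.Adj]
    (S T : Finset W) : ecount H S T ≤ vol H S := by
  rw [ecount_eq_sum, vol]
  refine Finset.sum_le_sum fun v _ => ?_
  rw [← H.card_neighborFinset_eq_degree]
  exact Finset.card_le_card Finset.inter_subset_left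

theorem ecount_inter_add_sdiff [DecidableEq W] (H : SimpleGraph W) [DecidableRel H.Adj]
    (S T U : Finset W) : ecount H S (T ∩ U) + ecount H S (T \ U) = ecount H S T := by
  rw [ecount, ecount, ecount, ← Finset.card_union_of_disjoint, ← Finset.filter_union,
    ← Finset.product_union, Finset.inter_comm, Finset.union_comm, Finset.inter_comm,
    Finset.sdiff_union_inter]
  refine Finset.disjoint_filter_filter (Finset.disjoint_product.2 (Or.inr ?_))
  exact (Finset.disjoint_sdiff_inter T U).symm

/-- A sum over `S` splits along a partition of the ground set into three parts. -/
theorem sum_eq_sum_inter_three [Fintype W] [DecidableEq W] {V L R : Finset W}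
    (hVL : Disjoint V L) (hVR : Disjoint V R) (hLR : Disjoint L R)
    (hcover : V ∪ L ∪ R = Finset.univ) (S : Finset W) (f : W → ℕ) :
    ∑ v ∈ S, f v = ∑ v ∈ S ∩ V, f v + ∑ v ∈ S ∩ L, f v + ∑ v ∈ S ∩ R, f v := by
  have hS : S = S ∩ V ∪ S ∩ L ∪ S ∩ R := by
    rw [← Finset.inter_union_distrib_left, ← Finset.inter_union_distrib_left, hcover,
      Finset.inter_univ]
  conv_lhs => rw [hS]
  rw [Finset.sum_union, Finset.sum_union]
  · exact hVL.mono Finset.inter_subset_right Finset.inter_subset_right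
  · rw [Finset.disjoint_union_left]
    exact ⟨hVR.mono Finset.inter_subset_right Finset.inter_subset_right,
      hLR.mono Finset.inter_subset_right Finset.inter_subset_right⟩

theorem degree_eq_sum_card_inter [Fintype W] [DecidableEq W] (H : SimpleGraph W)
    [DecidableRel H.Adj] {V L R : Finset W}
    (hVL : Disjoint V L) (hVR : Disjoint V R) (hLR : Disjoint L R)
    (hcover : V ∪ L ∪ R = Finset.univ) (v : W) :
    H.degree v = (H.neighborFinset v ∩ V).card + (H.neighborFinset v ∩ L).card +
      (H.neighborFinset v ∩ R).card := by
  have := sum_eq_sum_inter_three hVL hVR hLR hcover (H.neighborFinset v) fun _ => 1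
  simpa using this

theorem vol_pos [Fintype W] (H : SimpleGraph W) [DecidableRel H.Adj] {S : Finset W}
    (hS : S.Nonempty) (hdeg : ∀ v, 0 < H.degree v) : 0 < vol H S :=
  Finset.sum_pos (fun v _ => hdeg v) hS

/-- If the edges inside `V` are dominated by the edges from `V` to `L`, then the volume of a
subset of `V`, scaled by `ε`, is at most twice the number of edges it sends to `L`. -/
theorem mul_vol_le_two_mul_ecount [Fintype W] [DecidableEq W] (H : SimpleGraph W)
    [DecidableRel H.Adj] {V L A : Finset W} {ε : ℝ} (hε1 : ε ≤ 1) (hA : A ⊆ V)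
    (hdeg : ∀ v ∈ V,
      H.degree v = (H.neighborFinset v ∩ V).card + (H.neighborFinset v ∩ L).card)
    (hVtoL : ∀ v ∈ V,
      ε * ((H.neighborFinset v ∩ V).card : ℝ) + 1 ≤ ((H.neighborFinset v ∩ L).card : ℝ)) :
    ε * (vol H A : ℝ) ≤ 2 * (ecount H A L : ℝ) := by
  rw [ecount_eq_sum, vol]
  push_cast
  rw [Finset.mul_sum, Finset.mul_sum]
  refine Finset.sum_le_sum fun v hv => ?_
  rw [hdeg v (hA hv)]
  push_cast
  have h := hVtoL v (hA hv)
  have h' := mul_le_of_le_one_left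
    (Nat.cast_nonneg (α := ℝ) (H.neighborFinset v ∩ L).card) hε1
  linarith

/-- The volume bound for a cut side containing at most `N` vertices of `L ∪ R`, in terms of the
cut edges inside the bipartite graph and the cut edges between `V` and `L`. -/
theorem mul_vol_le_mul_ecount_compl [Fintype W] [DecidableEq W]
    (H : SimpleGraph W) [DecidableRel H.Adj]
    {V L R : Finset W} {N dX : ℕ} {ε α φ : ℝ}
    (hε1 : ε ≤ 1) (hα : 1 ≤ α) (hφ0 : 0 < φ) (hφ1 : φ ≤ 1)
    (hVL : Disjoint V L) (hVR : Disjoint V R) (hLR : Disjoint L R)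
    (hcover : V ∪ L ∪ R = Finset.univ)
    (hdegV : ∀ v ∈ V,
      H.degree v = (H.neighborFinset v ∩ V).card + (H.neighborFinset v ∩ L).card)
    (hVtoL : ∀ v ∈ V,
      ε * ((H.neighborFinset v ∩ V).card : ℝ) + 1 ≤ ((H.neighborFinset v ∩ L).card : ℝ))
    (hdegR : ∀ y ∈ R, H.degree y = dX)
    (hXexp : ∀ T ⊆ L ∪ R, T.card ≤ N →
      φ * (dX : ℝ) * (T.card : ℝ) ≤
        ((ecount H (T ∩ L) (R \ T) + ecount H (T ∩ R) (L \ T) : ℕ) : ℝ))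
    (hLdeg : ∀ x ∈ L, (H.degree x : ℝ) ≤ α * (dX : ℝ))
    {S : Finset W} (hS : (S ∩ (L ∪ R)).card ≤ N) :
    φ * ε * (vol H S : ℝ) ≤ 3 * α * (ecount H S Sᶜ : ℝ) := by
  have hvol : vol H S = vol H (S ∩ V) + vol H (S ∩ L) + vol H (S ∩ R) :=
    sum_eq_sum_inter_three hVL hVR hLR hcover S _
  have hcut : ecount H (S ∩ V) (L \ S) + ecount H (S ∩ L) (R \ S) + ecount H (S ∩ R) (L \ S) ≤
      ecount H S Sᶜ := by
    have hsplit : ecount H S Sᶜ =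
        ecount H (S ∩ V) Sᶜ + ecount H (S ∩ L) Sᶜ + ecount H (S ∩ R) Sᶜ := by
      simp only [ecount_eq_sum]
      exact sum_eq_sum_inter_three hVL hVR hLR hcover S _
    have hsub (U : Finset W) : U \ S ⊆ Sᶜ := fun x hx => by
      simpa using (Finset.mem_sdiff.1 hx).2
    rw [hsplit]
    exact add_le_add (add_le_add (ecount_mono H subset_rfl (hsub L))
      (ecount_mono H subset_rfl (hsub R))) (ecount_mono H subset_rfl (hsub L))
  have hexp := hXexp (S ∩ (L ∪ R)) Finset.inter_subset_right hS
  have hTL : S ∩ (L ∪ R) ∩ L = S ∩ L := by ext; simp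
  have hTR : S ∩ (L ∪ R) ∩ R = S ∩ R := by ext; simp
  have hRT : R \ (S ∩ (L ∪ R)) = R \ S := by ext; simp; tauto
  have hLT : L \ (S ∩ (L ∪ R)) = L \ S := by ext; simp; tauto
  rw [hTL, hTR, hRT, hLT] at hexp
  have hcard : (S ∩ (L ∪ R)).card = (S ∩ L).card + (S ∩ R).card := by
    rw [Finset.inter_union_distrib_left, Finset.card_union_of_disjoint]
    exact hLR.mono Finset.inter_subset_right Finset.inter_subset_right
  have hvolV := mul_vol_le_two_mul_ecount H (A := S ∩ V) hε1 Finset.inter_subset_right hdegV hVtoL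
  have hVtoS : ecount H (S ∩ V) (L ∩ S) ≤ vol H (S ∩ L) := by
    rw [ecount_comm, Finset.inter_comm L S]
    exact ecount_le_vol H _ _
  have hVsplit := ecount_inter_add_sdiff H (S ∩ V) L S
  have hvolL : (vol H (S ∩ L) : ℝ) ≤ α * dX * (S ∩ L).card := by
    rw [vol]
    push_cast
    rw [mul_comm, ← nsmul_eq_mul]
    exact Finset.sum_le_card_nsmul _ _ _ fun x hx => hLdeg x (Finset.mem_inter.1 hx).2
  have hvolR : vol H (S ∩ R) = (S ∩ R).card * dX := by
    rw [vol, ← smul_eq_mul]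
    exact Finset.sum_eq_card_nsmul fun y hy => hdegR y (Finset.mem_inter.1 hy).2
  generalize (S ∩ (L ∪ R)).card = t at *
  generalize (S ∩ L).card = l at *
  generalize (S ∩ R).card = r at *
  generalize vol H (S ∩ V) = a at *
  generalize vol H (S ∩ L) = b at *
  generalize vol H (S ∩ R) = c at *
  generalize ecount H (S ∩ V) (L \ S) = e at *
  generalize ecount H (S ∩ V) (L ∩ S) = e' at *
  generalize ecount H (S ∩ V) L = m at *
  generalize ecount H (S ∩ L) (R \ S) = p at *
  generalize ecount H (S ∩ R) (L \ S) = q at *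
  rw [hvol]
  subst hVsplit hcard hvolR
  rify at hcut hVtoS hexp hvolV ⊢
  have hd0 : (0 : ℝ) ≤ dX := Nat.cast_nonneg _
  have hl0 : (0 : ℝ) ≤ l := Nat.cast_nonneg _
  have hr0 : (0 : ℝ) ≤ r := Nat.cast_nonneg _
  have he0 : (0 : ℝ) ≤ e := Nat.cast_nonneg _
  have hb0 : (0 : ℝ) ≤ b := Nat.cast_nonneg _
  have hrd : (r : ℝ) * dX ≤ α * dX * r := by
    have := mul_le_mul_of_nonneg_right hα (mul_nonneg hr0 hd0)
    linarith
  have hεb : ε * b ≤ b := mul_le_of_le_one_left hb0 hε1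
  have hεr : ε * (r * dX) ≤ r * dX := mul_le_of_le_one_left (mul_nonneg hr0 hd0) hε1
  have hαr : 0 ≤ α * dX * r := by positivity
  have hside : ε * (a + b + r * dX) ≤ 3 * (α * dX * (l + r)) + 2 * e := by linarith
  have hφe : φ * e ≤ α * e := mul_le_mul_of_nonneg_right (hφ1.trans hα) he0
  have hαe : 0 ≤ α * e := by positivity
  calc φ * ε * (a + b + r * dX) = φ * (ε * (a + b + r * dX)) := by ring
    _ ≤ φ * (3 * (α * dX * (l + r)) + 2 * e) := mul_le_mul_of_nonneg_left hside hφ0.le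
    _ = 3 * α * (φ * dX * (l + r)) + 2 * (φ * e) := by ring
    _ ≤ 3 * α * (p + q) + 3 * α * e := by
      have := mul_le_mul_of_nonneg_left hexp (show 0 ≤ 3 * α by positivity)
      linarith
    _ = 3 * α * (e + p + q) := by ring
    _ ≤ _ := mul_le_mul_of_nonneg_left hcut (by positivity)

/-- The robust (generalized) core gadget: if every `v ∈ V` has at least
`ε·deg_G(v) + 1` neighbors in `L`, the `L–R` graph `X` is a `d_X`-regular
`φ·d_X`-edge expander, and every `x ∈ L` has degree in `[d_X, α·d_X]`,
then `H` is a `(φε/(5α))`-expander. -/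
theorem robust_coreGadget_isExpander [Fintype W] [DecidableEq W]
    (H : SimpleGraph W) [DecidableRel H.Adj]
    (V L R : Finset W) (N dX : ℕ) (ε α φ : ℝ)
    (hLcard : L.card = N) (hRcard : R.card = N) (hN : 1 ≤ N)
    (hε0 : 0 < ε) (hε1 : ε ≤ 1) (hα : 1 ≤ α) (hdX : 3 ≤ dX)
    (hφ0 : 0 < φ) (hφ1 : φ ≤ 1)
    (hVL : Disjoint V L) (hVR : Disjoint V R) (hLR : Disjoint L R)
    (hcover : V ∪ L ∪ R = Finset.univ)
    -- (i) every edge lies inside V, between V and L, or between L and R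
    (hedge : ∀ u v : W, H.Adj u v →
      (u ∈ V ∧ v ∈ V) ∨ (u ∈ V ∧ v ∈ L) ∨ (u ∈ L ∧ v ∈ V) ∨
      (u ∈ L ∧ v ∈ R) ∨ (u ∈ R ∧ v ∈ L))
    -- (ii) every v ∈ V has at least ε·deg_G(v) + 1 neighbors in L
    (hVtoL : ∀ v ∈ V,
      ε * ((H.neighborFinset v ∩ V).card : ℝ) + 1 ≤ ((H.neighborFinset v ∩ L).card : ℝ))
    -- (iii) the bipartite graph X of L–R edges is d_X-regular ...
    (hXregL : ∀ x ∈ L, (H.neighborFinset x ∩ R).card = dX)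
    (hXregR : ∀ y ∈ R, (H.neighborFinset y ∩ L).card = dX)
    -- ... and a φ·d_X-edge expander
    (hXexp : ∀ T ⊆ L ∪ R, T.card ≤ N →
      φ * (dX : ℝ) * (T.card : ℝ) ≤
        ((ecount H (T ∩ L) (R \ T) + ecount H (T ∩ R) (L \ T) : ℕ) : ℝ))
    -- (iv) every x ∈ L has degree in H in the interval [d_X, α·d_X]
    (hLdeg : ∀ x ∈ L, (dX : ℝ) ≤ (H.degree x : ℝ) ∧ (H.degree x : ℝ) ≤ α * (dX : ℝ)) :
    IsExpander H (φ * ε / (5 * α)) := by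
  have hdeg := degree_eq_sum_card_inter H hVL hVR hLR hcover
  have hnotVR : ∀ v ∈ V, v ∉ R := fun _ hv => Finset.disjoint_left.1 hVR hv
  have hnotVL : ∀ v ∈ V, v ∉ L := fun _ hv => Finset.disjoint_left.1 hVL hv
  have hnotLR : ∀ v ∈ L, v ∉ R := fun _ hv => Finset.disjoint_left.1 hLR hv
  have hdegV : ∀ v ∈ V,
      H.degree v = (H.neighborFinset v ∩ V).card + (H.neighborFinset v ∩ L).card := by
    intro v hv
    have hemp : H.neighborFinset v ∩ R = ∅ := by
      ext w
      simp only [Finset.mem_inter, SimpleGraph.mem_neighborFinset, Finset.notMem_empty, iff_false]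
      rintro ⟨hadj, hw⟩
      have := hedge v w hadj
      grind
    rw [hdeg, hemp, Finset.card_empty, add_zero]
  have hdegR : ∀ y ∈ R, H.degree y = dX := by
    intro y hy
    have hV : H.neighborFinset y ∩ V = ∅ := by
      ext w
      simp only [Finset.mem_inter, SimpleGraph.mem_neighborFinset, Finset.notMem_empty, iff_false]
      rintro ⟨hadj, hw⟩
      have := hedge y w hadj
      grind
    have hR : H.neighborFinset y ∩ R = ∅ := by
      ext w
      simp only [Finset.mem_inter, SimpleGraph.mem_neighborFinset, Finset.notMem_empty, iff_false]
      rintro ⟨hadj, hw⟩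
      have := hedge y w hadj
      grind
    rw [hdeg, hV, hR, hXregR y hy, Finset.card_empty, zero_add, add_zero]
  have hpos : ∀ v, 0 < H.degree v := by
    intro v
    have hv : v ∈ V ∪ L ∪ R := hcover ▸ Finset.mem_univ v
    rcases Finset.mem_union.1 hv with hv | hv
    · rcases Finset.mem_union.1 hv with hv | hv
      · have h1 : (1 : ℝ) ≤ ((H.neighborFinset v ∩ L).card : ℝ) :=
          (le_add_of_nonneg_left (by positivity)).trans (hVtoL v hv)
        have h2 : 1 ≤ (H.neighborFinset v ∩ L).card := by exact_mod_cast h1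
        rw [hdegV v hv]
        omega
      · rw [hdeg, hXregL v hv]
        omega
    · rw [hdegR v hv]
      omega
  have key : ∀ S : Finset W, (S ∩ (L ∪ R)).card ≤ N →
      φ * ε / (5 * α) * (vol H S : ℝ) ≤ (ecount H S Sᶜ : ℝ) := by
    intro S hS
    have h := mul_vol_le_mul_ecount_compl H hε1 hα hφ0 hφ1 hVL hVR hLR hcover hdegV hVtoL
      hdegR hXexp (fun x hx => (hLdeg x hx).2) hS
    have h0 : 0 ≤ α * (ecount H S Sᶜ : ℝ) := by positivity
    rw [div_mul_eq_mul_div, div_le_iff₀ (by positivity)]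
    linarith
  have hc0 : 0 ≤ φ * ε / (5 * α) := by positivity
  intro S hne huniv
  have hne' : Sᶜ.Nonempty := by
    rw [Finset.nonempty_iff_ne_empty]
    simpa using huniv
  refine ⟨lt_min (vol_pos H hne hpos) (vol_pos H hne' hpos), ?_⟩
  by_cases hS : (S ∩ (L ∪ R)).card ≤ N
  · exact (mul_le_mul_of_nonneg_left (min_le_left _ _) hc0).trans (key S hS)
  · have hsum : (S ∩ (L ∪ R)).card + (Sᶜ ∩ (L ∪ R)).card = N + N := by
      have hcard := Finset.card_union_of_disjoint hLR
      rw [hLcard, hRcard] at hcard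
      rw [← hcard, ← Finset.card_union_of_disjoint, ← Finset.union_inter_distrib_right,
        Finset.union_compl, Finset.univ_inter]
      exact disjoint_compl_right.mono Finset.inter_subset_left Finset.inter_subset_left
    have h := key Sᶜ (by omega)
    rw [compl_compl, ecount_comm] at h
    exact (mul_le_mul_of_nonneg_left (min_le_right _ _) hc0).trans h
end
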